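/- For every N > 0, the triple (PC^tt_∞(K_N, Σ_N), ≤, r) is a topological Ramsey space. -/

import Mathlib

open Filter

/- Example 2.13 of Roslanowski–Shelah.  H_N(n) = N.  An element of K_N is an FP
creature t = (nor[t], val[t], dis[t], m^t_dn, m^t_up) with dis[t] = (X_t, φ_t),
X_t ⊊ [m^t_dn, m^t_up), φ_t : X_t → N, nor[t] = m^t_up, and val[t] determined as the
set of f : [m^t_dn, m^t_up) → N with φ_t ⊆ f which are constant on
[m^t_dn, m^t_up) ∖ X_t.  Partial finitary functions are modelled as g : ℕ → Option ℕ
with domain {j | (g j).isSome}; nor[t] and val[t] are determined by the remaining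
data and are given by `CreatureN.mup` and `valN` below. -/
structure CreatureN (N : ℕ) where
  mdn : ℕ
  mup : ℕ
  hm : mdn < mup
  X : Finset ℕ
  hX : X ⊂ Finset.Ico mdn mup
  phi : ℕ → Option ℕ
  hdom : ∀ j, (phi j).isSome ↔ j ∈ X
  hran : ∀ j a, phi j = some a → a < N

/- val[t] = {f : [m^t_dn, m^t_up) → N : φ_t ⊆ f and f constant on
[m^t_dn, m^t_up) ∖ X_t}. -/
def valN (N : ℕ) (t : CreatureN N) : Set (ℕ → Option ℕ) :=
  {f | (∀ j, (f j).isSome ↔ j ∈ Finset.Ico t.mdn t.mup) ∧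
       (∀ j a, f j = some a → a < N) ∧
       (∀ j ∈ t.X, f j = t.phi j) ∧
       ∃ cst, ∀ j ∈ Finset.Ico t.mdn t.mup, j ∉ t.X → f j = some cst}

/- Σ_N(s_a, …, s_b): creatures t with the stated endpoints, ⋃_{a≤l≤b} X_{s_l} ⊆ X_t,
and for each a ≤ l ≤ b either X_t ∩ [m^{s_l}_dn, m^{s_l}_up) = X_{s_l} and
φ_t↾[m^{s_l}_dn, m^{s_l}_up) = φ_{s_l}, or [m^{s_l}_dn, m^{s_l}_up) ⊊ X_t and
φ_t↾[m^{s_l}_dn, m^{s_l}_up) ∈ val[s_l]. -/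
def SigmaN (N : ℕ) (s : ℕ → CreatureN N) (a b : ℕ) : Set (CreatureN N) :=
  {t | t.mdn = (s a).mdn ∧ t.mup = (s b).mup ∧
    (∀ l, a ≤ l → l ≤ b → (s l).X ⊆ t.X) ∧
    ∀ l, a ≤ l → l ≤ b →
      ((t.X ∩ Finset.Ico (s l).mdn (s l).mup = (s l).X ∧
        ∀ j ∈ Finset.Ico (s l).mdn (s l).mup, t.phi j = (s l).phi j) ∨
       (Finset.Ico (s l).mdn (s l).mup ⊂ t.X ∧
        (fun j => if j ∈ Finset.Ico (s l).mdn (s l).mup then t.phi j else none)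
          ∈ valN N (s l)))}

/- Tight pure candidates: m^{t_n}_up = m^{t_{n+1}}_dn and nor[t_n] = m^{t_n}_up → ∞. -/
def PCttN (N : ℕ) (t : ℕ → CreatureN N) : Prop :=
  (∀ n, (t n).mup = (t (n + 1)).mdn) ∧
  Tendsto (fun n => (t n).mup) atTop atTop

/- t̄ ≤ s̄ iff there is a strictly increasing (j_n) with
t_n ∈ Σ_N(s_{j_n}, …, s_{j_{n+1}−1}) for all n. -/
def leN (N : ℕ) (t s : ℕ → CreatureN N) : Prop :=
  ∃ j : ℕ → ℕ, StrictMono j ∧ ∀ n, t n ∈ SigmaN N s (j n) (j (n + 1) - 1)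

/- r_k(t̄) = (t_0, …, t_{k−1}). -/
def restrN (N : ℕ) (t : ℕ → CreatureN N) (k : ℕ) : List (CreatureN N) :=
  List.ofFn (fun i : Fin k => t i.1)

/- The space PC^tt_∞(K_N, Σ_N). -/
def RN (N : ℕ) := {t : ℕ → CreatureN N // PCttN N t}

/- The Ellentuck basic set [a, X] = {Y : Y ≤ X and r_{|a|}(Y) = a}. -/
def EBasicN (N : ℕ) (a : List (CreatureN N)) (X : RN N) : Set (RN N) :=
  {Y | leN N Y.1 X.1 ∧ restrN N Y.1 a.length = a}

/- The Ellentuck topology, generated by the sets [a, X]. -/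
def ellTN (N : ℕ) : TopologicalSpace (RN N) :=
  TopologicalSpace.generateFrom {S | ∃ a X, S = EBasicN N a X}

/- 𝓧 is Ramsey: for every nonempty [a, X] there is Y ∈ [a, X] with [a, Y] ⊆ 𝓧 or
[a, Y] ∩ 𝓧 = ∅. -/
def RamseyN (N : ℕ) (𝓧 : Set (RN N)) : Prop :=
  ∀ a X, (EBasicN N a X).Nonempty →
    ∃ Y ∈ EBasicN N a X, EBasicN N a Y ⊆ 𝓧 ∨ EBasicN N a Y ∩ 𝓧 = ∅

/- 𝓧 is Ramsey null: for every nonempty [a, X] there is Y ∈ [a, X] with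
[a, Y] ∩ 𝓧 = ∅. -/
def RamseyNullN (N : ℕ) (𝓧 : Set (RN N)) : Prop :=
  ∀ a X, (EBasicN N a X).Nonempty → ∃ Y ∈ EBasicN N a X, EBasicN N a Y ∩ 𝓧 = ∅

/- 𝓧 has the property of Baire in the Ellentuck topology. -/
def BairePropN (N : ℕ) (𝓧 : Set (RN N)) : Prop :=
  ∃ O : Set (RN N), @IsOpen (RN N) (ellTN N) O ∧
    @IsMeagre (RN N) (ellTN N) (symmDiff 𝓧 O)

section Ultra
open Filter
attribute [local instance] Ultrafilter.mul Ultrafilter.semigroup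

theorem exists_minimal_idem {M : Type*} [Semigroup M] [TopologicalSpace M] [CompactSpace M]
    [T2Space M] (hc : ∀ r : M, Continuous (· * r)) (K : Set M) (hK : IsClosed K)
    (hne : K.Nonempty) (hmul : ∀ x ∈ K, ∀ y ∈ K, x * y ∈ K) :
    ∃ p ∈ K, p * p = p ∧ ∀ r ∈ K, r * r = r → r * p = r → p * r = r → r = p := by
  let S : Set (Set M) :=
    { L | IsClosed L ∧ L.Nonempty ∧ L ⊆ K ∧ ∀ x ∈ K, ∀ y ∈ L, x * y ∈ L }
  obtain ⟨L, hLK, hL⟩ : ∃ L, L ⊆ K ∧ Minimal (· ∈ S) L := by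
    refine zorn_superset_nonempty S (fun c hcs hch hcne => ?_) K ⟨hK, hne, subset_rfl, hmul⟩
    refine ⟨⋂₀ c, ⟨isClosed_sInter fun t ht => (hcs ht).1, ?_, ?_, ?_⟩, fun s hs =>
      Set.sInter_subset_of_mem hs⟩
    · have := hcne.coe_sort
      rw [Set.sInter_eq_iInter]
      refine IsCompact.nonempty_iInter_of_directed_nonempty_isCompact_isClosed
        ((↑) : c → Set M) ?_ (fun i => (hcs i.prop).2.1) (fun i => (hcs i.prop).1.isCompact)
        (fun i => (hcs i.prop).1)
      exact DirectedOn.directed_val (IsChain.directedOn hch.symm)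
    · obtain ⟨t, ht⟩ := hcne
      exact (Set.sInter_subset_of_mem ht).trans (hcs ht).2.2.1
    · intro x hx y hy t ht
      exact (hcs ht).2.2.2 x hx y (hy t ht)
  obtain ⟨Lc, Lne, LK, Lmul⟩ := hL.prop
  obtain ⟨p, hp, hpp⟩ := exists_idempotent_in_compact_subsemigroup hc L Lne Lc.isCompact
    (fun x hx y hy => Lmul x (LK hx) y hy)
  refine ⟨p, LK hp, hpp, fun r hr hrr hrp hpr => ?_⟩
  have hrL : r ∈ L := hrp ▸ Lmul r hr p hp
  have : (· * r) '' K = L := by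
    apply hL.eq_of_subset
    · refine ⟨(hc r).isClosedMap _ hK, hne.image _, ?_, ?_⟩
      · rintro _ ⟨x, hx, rfl⟩; exact hmul x hx r hr
      · rintro x hx _ ⟨y, hy, rfl⟩
        exact ⟨x * y, hmul x hx y hy, mul_assoc _ _ _⟩
    · rintro _ ⟨x, hx, rfl⟩; exact Lmul x hx r hrL
  rw [← this] at hp
  obtain ⟨y, hy, rfl⟩ := hp
  simp only at hpr
  rw [mul_assoc, hrr] at hpr
  exact hpr.symm

theorem ultra_map_mul {T : Type*} [Semigroup T] (f : T → T) (hf : ∀ x y, f (x * y) = f x * f y)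
    (U V : Ultrafilter T) : (U * V).map f = U.map f * V.map f := by
  apply Ultrafilter.coe_inj.mp
  refine Filter.ext' fun P => ?_
  rw [Ultrafilter.eventually_mul]
  simp only [Ultrafilter.coe_map, Filter.eventually_map]
  rw [Ultrafilter.eventually_mul]
  simp only [hf]

theorem ultra_mem_mul {T : Type*} [Semigroup T] (U V : Ultrafilter T) (s : Set T) :
    s ∈ U * V ↔ ∀ᶠ x in U, ∀ᶠ y in V, x * y ∈ s := Iff.rfl

theorem exists_pq {T ι : Type*} [Semigroup T] (W V : Set T) (hW : W.Nonempty)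
    (hWm : ∀ x ∈ W, ∀ y ∈ W, x * y ∈ W) (hV : V.Nonempty)
    (hVl : ∀ x, ∀ y ∈ V, x * y ∈ V) (hVr : ∀ x, ∀ y ∈ V, y * x ∈ V)
    (θ : ι → T → T) (hθm : ∀ a x y, θ a (x * y) = θ a x * θ a y)
    (hθW : ∀ a x, θ a x ∈ W) (hθ : ∀ a, ∀ x ∈ W, θ a x = x) :
    ∃ p q : Ultrafilter T, W ∈ p ∧ V ∈ q ∧ p * p = p ∧ q * q = q ∧ p * q = q ∧ q * p = q ∧
      ∀ a, q.map (θ a) = p := by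
  have hc := fun r : Ultrafilter T => Ultrafilter.continuous_mul_left r
  have hcl : ∀ s : Set T, IsClosed {u : Ultrafilter T | s ∈ u} := ultrafilter_isClosed_basic
  obtain ⟨w0, hw0⟩ := hW
  obtain ⟨v0, hv0⟩ := hV
  obtain ⟨p, hpW, hpp, hmin⟩ := exists_minimal_idem hc {u | W ∈ u} (hcl W)
    ⟨pure w0, by simpa using hw0⟩ (by
      intro x hx y hy
      change W ∈ x * y
      rw [ultra_mem_mul]
      filter_upwards [hx] with a ha
      filter_upwards [hy] with b hb using hWm a ha b hb)
  have hVi : ∀ x y : Ultrafilter T, V ∈ x → V ∈ x * y := by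
    intro x y hx
    rw [ultra_mem_mul]
    filter_upwards [hx] with a ha
    exact Eventually.of_forall fun b => hVr b a ha
  have hVi2 : ∀ x y : Ultrafilter T, V ∈ y → V ∈ x * y := by
    intro x y hy
    rw [ultra_mem_mul]
    refine Eventually.of_forall fun a => ?_
    filter_upwards [hy] with b hb using hVl a b hb
  obtain ⟨e, ⟨x, hx, hxe⟩, hee⟩ := exists_idempotent_in_compact_subsemigroup hc
    ((· * p) '' {u | V ∈ u}) (Set.Nonempty.image _ ⟨pure v0, by simpa using hv0⟩)
    ((hcl V).isCompact.image (hc p)) (by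
      rintro _ ⟨x, hx, rfl⟩ _ ⟨y, hy, rfl⟩
      exact ⟨x * p * y, hVi _ _ (hVi _ _ hx), mul_assoc _ _ _⟩)
  simp only at hxe
  have hep : e * p = e := by rw [← hxe, mul_assoc, hpp]
  have hVe : V ∈ e := by rw [← hxe]; exact hVi _ _ hx
  have hqq : (p * e) * (p * e) = p * e := by
    rw [mul_assoc, ← mul_assoc e p e, hep, hee]
  have hpq : p * (p * e) = p * e := by rw [← mul_assoc, hpp]
  have hqp : (p * e) * p = p * e := by rw [mul_assoc, hep]
  refine ⟨p, p * e, hpW, hVi2 _ _ hVe, hpp, hqq, hpq, hqp, fun a => ?_⟩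
  have hpa : p.map (θ a) = p := by
    apply Ultrafilter.coe_inj.mp
    rw [Ultrafilter.coe_map]
    conv_rhs => rw [← Filter.map_id (f := (p : Filter T))]
    apply Filter.map_congr
    filter_upwards [hpW] with x hx using hθ a x hx
  refine hmin _ ?_ ?_ ?_ ?_
  · change W ∈ Ultrafilter.map (θ a) (p * e)
    rw [Ultrafilter.mem_map]
    exact Filter.univ_mem' (fun x => hθW a x)
  · rw [← ultra_map_mul _ (hθm a), hqq]
  · have h := ultra_map_mul (θ a) (hθm a) (p * e) p
    rw [hqp, hpa] at h
    exact h.symm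
  · have h := ultra_map_mul (θ a) (hθm a) p (p * e)
    rw [hpq, hpa] at h
    exact h.symm

@[reducible] def listSg (L : Type*) : Semigroup (List L) where
  mul := fun x y => x ++ y
  mul_assoc := List.append_assoc

attribute [local instance] listSg

def subW {N : ℕ} (u : Option (Fin N)) (w : List (Option (Fin N))) : List (Option (Fin N)) :=
  w.map (fun o => o.or u)

def flatW {N : ℕ} (w : ℕ → List (Option (Fin N))) (u : ℕ → Option (Fin N)) :
    ℕ → List (Option (Fin N))
  | 0 => []
  | k + 1 => flatW w u k ++ subW (u k) (w k)

theorem subW_none {N : ℕ} (w : List (Option (Fin N))) : subW none w = w := by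
  simp [subW]

theorem subW_some_nvar {N : ℕ} (a : Fin N) (w : List (Option (Fin N))) :
    none ∉ subW (some a) w := by
  simp [subW]

theorem subW_id {N : ℕ} (a : Fin N) (w : List (Option (Fin N))) (h : none ∉ w) :
    subW (some a) w = w := by
  unfold subW
  conv_rhs => rw [← List.map_id w]
  apply List.map_congr_left
  intro o ho
  cases o with
  | none => exact absurd ho h
  | some b => rfl

theorem exists_words_aux {N : ℕ} (p q : Ultrafilter (List (Option (Fin N))))
    (hp : {w | none ∉ w} ∈ p) (V : Set (List (Option (Fin N)))) (hV : V ∈ q)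
    (hpp : p * p = p) (hqq : q * q = q) (hpq : p * q = q) (hqp : q * p = q)
    (hθ : ∀ a, q.map (subW (some a)) = p) (B : Set (List (Option (Fin N)))) (hB : B ∈ q) :
    ∃ w : ℕ → List (Option (Fin N)), (∀ i, w i ∈ V) ∧
      ∀ k u, none ∈ flatW w u k → flatW w u k ∈ B := by
  let Good : List (Option (Fin N)) → Prop := fun w =>
    (∀ᶠ x in q, w ++ x ∈ B) ∧ (none ∈ w → w ∈ B ∧ ∀ᶠ y in p, w ++ y ∈ B)
  have key : ∀ (U U' U'' : Ultrafilter (List (Option (Fin N)))), U * U' = U'' →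
      ∀ w, (∀ᶠ x in U'', w ++ x ∈ B) → ∀ᶠ x in U, ∀ᶠ y in U', w ++ x ++ y ∈ B := by
    intro U U' U'' h w hw
    rw [← h] at hw
    rw [Ultrafilter.eventually_mul] at hw
    filter_upwards [hw] with x hx
    filter_upwards [hx] with y hy
    rw [List.append_assoc]; exact hy
  have gq : ∀ w, Good w → ∀ᶠ x in q, Good (w ++ x) := by
    intro w ⟨h1, h2⟩
    filter_upwards [h1, key q q q hqq w h1, key q p q hqp w h1] with x a b c
    exact ⟨b, fun _ => ⟨a, c⟩⟩
  have gp : ∀ w, Good w → ∀ᶠ x in p, Good (w ++ x) := by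
    intro w ⟨h1, h2⟩
    by_cases hw : none ∈ w
    · obtain ⟨h3, h4⟩ := h2 hw
      filter_upwards [h4, key p q q hpq w h1, key p p p hpp w h4] with x a b c
      exact ⟨b, fun _ => ⟨a, c⟩⟩
    · filter_upwards [hp, key p q q hpq w h1] with x a b
      refine ⟨b, fun h => ?_⟩
      rcases List.mem_append.1 h with h | h
      · exact absurd h hw
      · exact absurd h a
  have gu : ∀ w, Good w → ∀ u, ∀ᶠ x in q, Good (w ++ subW u x) := by
    intro w hw u
    cases u with
    | none => simpa only [subW_none] using gq w hw
    | some a =>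
      have := gp w hw
      rw [← hθ a, Ultrafilter.coe_map, Filter.eventually_map] at this
      exact this
  have step : ∀ F : {F : Set (List (Option (Fin N))) // F.Finite ∧ ∀ w ∈ F, Good w},
      ∃ x ∈ V, ∀ w ∈ F.1, ∀ u, Good (w ++ subW u x) := by
    intro F
    have : ∀ᶠ x in q, ∀ w ∈ F.1, ∀ u, Good (w ++ subW u x) := by
      rw [Filter.eventually_all_finite F.2.1]
      intro w hw
      rw [Filter.eventually_all]
      exact gu w (F.2.2 w hw)
    obtain ⟨x, hx⟩ := (this.and hV).exists
    exact ⟨x, hx.2, hx.1⟩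
  choose x hxV hxG using step
  let nxt : {F : Set (List (Option (Fin N))) // F.Finite ∧ ∀ w ∈ F, Good w} →
      {F : Set (List (Option (Fin N))) // F.Finite ∧ ∀ w ∈ F, Good w} := fun F =>
    ⟨⋃ w ∈ F.1, Set.range (fun u => w ++ subW u (x F)),
      F.2.1.biUnion (fun w _ => Set.finite_range _), by
        intro v hv
        simp only [Set.mem_iUnion, Set.mem_range] at hv
        obtain ⟨w, hw, u, rfl⟩ := hv
        exact hxG F w hw u⟩
  let F : ℕ → {F : Set (List (Option (Fin N))) // F.Finite ∧ ∀ w ∈ F, Good w} := fun n =>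
    Nat.rec ⟨{[]}, Set.finite_singleton _, by
      intro w hw
      rw [Set.mem_singleton_iff] at hw
      subst hw
      exact ⟨by simpa using hB, by simp⟩⟩ (fun _ F => nxt F) n
  have hF : ∀ k u, flatW (fun i => x (F i)) u k ∈ (F k).1 := by
    intro k u
    induction k with
    | zero => exact Set.mem_singleton _
    | succ k ih =>
      change _ ∈ ⋃ w ∈ (F k).1, Set.range (fun u => w ++ subW u (x (F k)))
      simp only [Set.mem_iUnion, Set.mem_range]
      exact ⟨_, ih, u k, rfl⟩
  refine ⟨fun i => x (F i), fun i => hxV _, fun k u h => ?_⟩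
  exact (((F k).2.2 _ (hF k u)).2 h).1

theorem exists_words {N : ℕ} (hN : 0 < N) (A : Set (List (Option (Fin N)))) :
    ∃ w : ℕ → List (Option (Fin N)), (∀ i, none ∈ w i ∧ 2 ≤ (w i).countP (·.isSome)) ∧
      ((∀ k u, none ∈ flatW w u k → flatW w u k ∈ A) ∨
       (∀ k u, none ∈ flatW w u k → flatW w u k ∉ A)) := by
  obtain ⟨p, q, hp, hV, hpp, hqq, hpq, hqp, hθ⟩ := exists_pq
    {w : List (Option (Fin N)) | none ∉ w}
    {w | none ∈ w ∧ 2 ≤ w.countP (·.isSome)} ⟨[], by simp⟩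
    (by
      intro x hx y hy h
      rcases List.mem_append.1 h with h | h
      · exact hx h
      · exact hy h)
    ⟨[none, some ⟨0, hN⟩, some ⟨0, hN⟩], by simp⟩
    (by
      rintro x y ⟨h1, h2⟩
      refine ⟨List.mem_append_right _ h1, ?_⟩
      change 2 ≤ (x ++ y).countP _
      rw [List.countP_append]; omega)
    (by
      rintro x y ⟨h1, h2⟩
      refine ⟨List.mem_append_left _ h1, ?_⟩
      change 2 ≤ (y ++ x).countP _
      rw [List.countP_append]; omega)
    (fun a : Fin N => subW (some a)) (fun a x y => List.map_append)
    (fun a x => subW_some_nvar a x) (fun a x hx => subW_id a x hx)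
  by_cases hA : A ∈ q
  · obtain ⟨w, h1, h2⟩ := exists_words_aux p q hp _ hV hpp hqq hpq hqp hθ A hA
    exact ⟨w, h1, Or.inl h2⟩
  · obtain ⟨w, h1, h2⟩ := exists_words_aux p q hp _ hV hpp hqq hpq hqp hθ Aᶜ
      (Ultrafilter.compl_mem_iff_notMem.2 hA)
    exact ⟨w, h1, Or.inr h2⟩

end Ultra
section Basics
variable {N : ℕ}

theorem rn_mup (Y : RN N) (n : ℕ) : (Y.1 n).mup = (Y.1 (n + 1)).mdn := Y.2.1 n

theorem rn_mono (Y : RN N) : StrictMono (fun n => (Y.1 n).mdn) :=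
  strictMono_nat_of_lt_succ fun n => by
    have := (Y.1 n).hm
    rw [rn_mup] at this
    exact this

theorem rn_lt (Y : RN N) {a b : ℕ} : (Y.1 a).mdn < (Y.1 b).mdn ↔ a < b := (rn_mono Y).lt_iff_lt
theorem rn_le (Y : RN N) {a b : ℕ} : (Y.1 a).mdn ≤ (Y.1 b).mdn ↔ a ≤ b := (rn_mono Y).le_iff_le
theorem rn_inj (Y : RN N) {a b : ℕ} : (Y.1 a).mdn = (Y.1 b).mdn ↔ a = b :=
  (rn_mono Y).injective.eq_iff

def mkRN (f : ℕ → CreatureN N) (h : ∀ n, (f n).mup = (f (n + 1)).mdn) : RN N :=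
  ⟨f, h, by
    have : StrictMono (fun n => (f n).mup) := strictMono_nat_of_lt_succ fun n => by
      rw [h n]; exact (f (n + 1)).hm
    exact this.tendsto_atTop⟩

theorem rn_locate (Y : RN N) (x : ℕ) (hx : (Y.1 0).mdn ≤ x) :
    ∃ n, (Y.1 n).mdn ≤ x ∧ x < (Y.1 (n + 1)).mdn := by
  have hex : ∃ n, x < (Y.1 (n + 1)).mdn :=
    ⟨x, lt_of_lt_of_le (Nat.lt_succ_self x) ((rn_mono Y).le_apply)⟩
  classical
  refine ⟨Nat.find hex, ?_, Nat.find_spec hex⟩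
  by_cases h0 : Nat.find hex = 0
  · rw [h0]; exact hx
  · have := Nat.find_min hex (m := Nat.find hex - 1) (by omega)
    rw [Nat.sub_add_cancel (by omega)] at this
    omega

def LR (t c : CreatureN N) (o : Option (Fin N)) : Prop :=
  ∀ j ∈ Finset.Ico t.mdn t.mup, c.phi j = (t.phi j).or (o.map Fin.val)

def OKc (t c : CreatureN N) : Prop :=
  LR t c none ∨ ((∃ a, LR t c (some a)) ∧ Finset.Ico t.mdn t.mup ⊂ c.X)

theorem phi_none (t : CreatureN N) {j : ℕ} (h : j ∉ t.X) : t.phi j = none := by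
  rw [← t.hdom, Bool.not_eq_true, Option.isSome_eq_false_iff, Option.isNone_iff_eq_none] at h
  exact h

theorem cre_ext {c d : CreatureN N} (h1 : c.mdn = d.mdn) (h2 : c.mup = d.mup)
    (h3 : ∀ j, c.phi j = d.phi j) : c = d := by
  have hX : c.X = d.X := by
    ext j; rw [← c.hdom, ← d.hdom, h3]
  have h4 : c.phi = d.phi := funext h3
  clear h3
  cases c; cases d
  simp only at h1 h2 h4 hX
  subst h1 h2 h4 hX
  rfl

theorem okc_X {t c : CreatureN N} (h : OKc t c) : t.X ⊆ c.X := by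
  intro j hj
  have hI := t.hX.1 hj
  rcases h with h | h
  · rw [← c.hdom, h j hI]
    have := (t.hdom j).2 hj
    simp [this]
  · exact h.2.1 hI

theorem okc_iff (t c : CreatureN N) : OKc t c ↔
      ((c.X ∩ Finset.Ico t.mdn t.mup = t.X ∧
        ∀ j ∈ Finset.Ico t.mdn t.mup, c.phi j = t.phi j) ∨
       (Finset.Ico t.mdn t.mup ⊂ c.X ∧
        (fun j => if j ∈ Finset.Ico t.mdn t.mup then c.phi j else none)
          ∈ valN N t)) := by
  constructor
  · rintro (h | ⟨⟨a, h⟩, hX⟩)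
    · left
      have h' : ∀ j ∈ Finset.Ico t.mdn t.mup, c.phi j = t.phi j := by
        intro j hj; rw [h j hj]; simp
      refine ⟨?_, h'⟩
      ext j
      rw [Finset.mem_inter]
      constructor
      · rintro ⟨h1, h2⟩
        rw [← t.hdom, ← h' j h2, c.hdom]; exact h1
      · intro h1
        have h2 := t.hX.1 h1
        refine ⟨?_, h2⟩
        rw [← c.hdom, h' j h2, t.hdom]; exact h1
    · right
      refine ⟨hX, ?_, ?_, ?_, a, ?_⟩
      · intro j
        by_cases hj : j ∈ Finset.Ico t.mdn t.mup
        · simp only [hj, if_true, iff_true]; exact (c.hdom j).2 (hX.1 hj)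
        · simp [hj]
      · intro j b hb
        by_cases hj : j ∈ Finset.Ico t.mdn t.mup
        · simp only [hj, if_true] at hb; exact c.hran j b hb
        · simp [hj] at hb
      · intro j hj
        have hI := t.hX.1 hj
        simp only [hI, if_true]
        rw [h j hI]
        have := (t.hdom j).2 hj
        rw [Option.or_of_isSome this]
      · intro j hI hj
        simp only [hI, if_true]
        rw [h j hI, phi_none t hj]; rfl
  · rintro (⟨h1, h2⟩ | ⟨hX, h1, h2, h3, cst, h4⟩)
    · left
      intro j hj; rw [h2 j hj]; simp
    · right
      refine ⟨?_, hX⟩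
      obtain ⟨x, hxI, hx⟩ := Finset.exists_of_ssubset t.hX
      have hc := h2 x cst (h4 x hxI hx)
      refine ⟨⟨cst, hc⟩, ?_⟩
      intro j hj
      by_cases hjX : j ∈ t.X
      · have := h3 j hjX
        simp only [hj, if_true] at this
        rw [this, Option.or_of_isSome ((t.hdom j).2 hjX)]
      · have := h4 j hj hjX
        simp only [hj, if_true] at this
        rw [this, phi_none t hjX]; rfl

theorem okc_self (t : CreatureN N) : OKc t t := Or.inl fun j _ => by simp

theorem okc_trans {s t u : CreatureN N} (hs : Finset.Ico s.mdn s.mup ⊆ Finset.Ico t.mdn t.mup)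
    (h1 : OKc s t) (h2 : OKc t u) : OKc s u := by
  have comp : ∀ o o', LR s t o → LR t u o' → LR s u (o.or o') := by
    intro o o' a b j hj
    rw [b j (hs hj), a j hj, Option.or_assoc]
    cases o <;> simp
  have hX := okc_X h2
  rcases h1 with h1 | ⟨⟨a, h1⟩, hX1⟩
  · rcases h2 with h2 | ⟨⟨b, h2⟩, hX2⟩
    · exact Or.inl (comp _ _ h1 h2)
    · exact Or.inr ⟨⟨b, comp _ _ h1 h2⟩, Finset.ssubset_of_subset_of_ssubset hs hX2⟩
  · right
    refine ⟨⟨a, ?_⟩, Finset.ssubset_of_ssubset_of_subset hX1 hX⟩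
    rcases h2 with h2 | ⟨⟨b, h2⟩, hX2⟩
    · exact comp _ _ h1 h2
    · exact comp _ _ h1 h2

def Bel (s : RN N) (c : CreatureN N) : Prop :=
  (∃ a, c.mdn = (s.1 a).mdn) ∧ (∃ b, c.mup = (s.1 b).mdn) ∧
    ∀ l, c.mdn ≤ (s.1 l).mdn → (s.1 l).mdn < c.mup → OKc (s.1 l) c

theorem mem_sigma_iff (s : ℕ → CreatureN N) (a b : ℕ) (c : CreatureN N) :
    c ∈ SigmaN N s a b ↔ c.mdn = (s a).mdn ∧ c.mup = (s b).mup ∧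
      ∀ l, a ≤ l → l ≤ b → OKc (s l) c := by
  simp only [okc_iff]
  constructor
  · rintro ⟨h1, h2, h3, h4⟩
    exact ⟨h1, h2, h4⟩
  · rintro ⟨h1, h2, h4⟩
    refine ⟨h1, h2, ?_, h4⟩
    intro l ha hb
    exact okc_X ((okc_iff _ _).2 (h4 l ha hb))

theorem le_iff (t s : RN N) : leN N t.1 s.1 ↔ ∀ n, Bel s (t.1 n) := by
  constructor
  · rintro ⟨j, hj, h⟩ n
    obtain ⟨h1, h2, h3⟩ := (mem_sigma_iff _ _ _ _).1 (h n)
    have hjj : j n < j (n + 1) := hj (Nat.lt_succ_self n)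
    rw [rn_mup s, Nat.sub_add_cancel (by omega)] at h2
    refine ⟨⟨_, h1⟩, ⟨_, h2⟩, ?_⟩
    intro l ha hb
    rw [h1, rn_le] at ha
    rw [h2, rn_lt] at hb
    exact h3 l ha (by omega)
  · intro h
    choose j hj using fun n => (h n).1
    have hm : StrictMono j := strictMono_nat_of_lt_succ fun n => by
      rw [← rn_lt s, ← hj, ← hj, rn_lt]; omega
    refine ⟨j, hm, fun n => (mem_sigma_iff _ _ _ _).2 ⟨hj n, ?_, ?_⟩⟩
    · have hjj : j n < j (n + 1) := hm (Nat.lt_succ_self n)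
      rw [rn_mup s, Nat.sub_add_cancel (by omega), ← hj, rn_mup]
    · intro l ha hb
      have hjj : j n < j (n + 1) := hm (Nat.lt_succ_self n)
      refine (h n).2.2 l ?_ ?_
      · rw [hj, rn_le]; exact ha
      · rw [rn_mup, hj, rn_lt]; omega

theorem bel_self (s : RN N) (n : ℕ) : Bel s (s.1 n) := by
  refine ⟨⟨n, rfl⟩, ⟨n + 1, rn_mup s n⟩, ?_⟩
  intro l h1 h2
  rw [rn_mup, rn_lt] at h2
  rw [rn_le] at h1
  have : l = n := by omega
  subst this
  exact okc_self _

theorem bel_trans {s t : RN N} (h : ∀ n, Bel s (t.1 n)) {u : CreatureN N} (hu : Bel t u) :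
    Bel s u := by
  obtain ⟨⟨a, ha⟩, ⟨b, hb⟩, h3⟩ := hu
  refine ⟨?_, ?_, ?_⟩
  · rw [ha]; exact (h a).1
  · rw [hb]; exact (h b).1
  · intro l h1 h2
    obtain ⟨n, hn1, hn2⟩ := rn_locate t (s.1 l).mdn (by
      refine le_trans ?_ h1
      rw [ha, rn_le]; omega)
    have han : a ≤ n := by
      rw [ha] at h1
      have := lt_of_le_of_lt h1 hn2
      rw [rn_lt] at this; omega
    have hl := (h n).2.2 l hn1 (by rw [rn_mup]; exact hn2)
    have hn := h3 n (by rw [ha, rn_le]; exact han) (lt_of_le_of_lt hn1 h2)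
    refine okc_trans ?_ hl hn
    apply Finset.Ico_subset_Ico hn1
    obtain ⟨b', hb'⟩ := (h n).2.1
    rw [rn_mup s, hb', rn_le]
    rw [← rn_mup, hb', rn_lt] at hn2
    exact hn2

theorem leN_refl (s : RN N) : leN N s.1 s.1 := (le_iff _ _).2 (bel_self s)

theorem leN_trans {s t u : RN N} (h1 : leN N u.1 t.1) (h2 : leN N t.1 s.1) : leN N u.1 s.1 := by
  rw [le_iff] at *
  exact fun n => bel_trans h2 (h1 n)

theorem bel_transfer {Y Z : RN N} {c : CreatureN N} (hY : Bel Y c)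
    (h : ∀ l, c.mdn ≤ (Y.1 l).mdn → (Y.1 l).mdn < c.mup → ∃ l', Z.1 l' = Y.1 l) : Bel Z c := by
  obtain ⟨⟨a, ha⟩, ⟨b, hb⟩, h3⟩ := hY
  have hab : a < b := by
    have := c.hm
    rwa [ha, hb, rn_lt] at this
  refine ⟨?_, ?_, ?_⟩
  · obtain ⟨l', hl'⟩ := h a ha.le (by rw [← ha]; exact c.hm)
    exact ⟨l', by rw [hl', ha]⟩
  · obtain ⟨l', hl'⟩ := h (b - 1) (by rw [ha, rn_le]; omega) (by rw [hb, rn_lt]; omega)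
    refine ⟨l' + 1, ?_⟩
    rw [← rn_mup, hl', rn_mup, hb, Nat.sub_add_cancel (by omega)]
  · intro l h1 h2
    obtain ⟨n, hn1, hn2⟩ := rn_locate Y (Z.1 l).mdn (by
      refine le_trans ?_ h1
      rw [ha, rn_le]; omega)
    have han : a ≤ n := by
      rw [ha] at h1
      have := lt_of_le_of_lt h1 hn2
      rw [rn_lt] at this; omega
    have hn1' : c.mdn ≤ (Y.1 n).mdn := by rw [ha, rn_le]; exact han
    have hn2' := lt_of_le_of_lt hn1 h2
    obtain ⟨l', hl'⟩ := h n hn1' hn2'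
    have e1 := hn1
    have e2 := hn2
    rw [← hl', rn_le] at e1
    rw [← rn_mup, ← hl', rn_mup, rn_lt] at e2
    have : l = l' := by omega
    subst this
    rw [hl']
    exact h3 n hn1' hn2'

def graft (W : RN N) (n : ℕ) (Z : RN N) (d : ℕ) (h : n = 0 ∨ (W.1 n).mdn = (Z.1 d).mdn) : RN N :=
  mkRN (fun i => if i < n then W.1 i else Z.1 (d + (i - n))) (by
    intro i
    by_cases h1 : i + 1 < n
    · have h2 : i < n := by omega
      simp only [h1, h2, if_true]; exact rn_mup W i
    · by_cases h2 : i < n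
      · have h3 : i + 1 = n := by omega
        simp only [h1, h2, if_true, if_false]
        rw [rn_mup, h3]
        simp only [Nat.sub_self, Nat.add_zero]
        rcases h with h | h
        · omega
        · exact h
      · simp only [h1, h2, if_false]
        rw [rn_mup]
        rw [show d + (i - n) + 1 = d + (i + 1 - n) by omega])

theorem graft_lt (W : RN N) (n : ℕ) (Z : RN N) (d : ℕ) (h) {i : ℕ} (hi : i < n) :
    (graft W n Z d h).1 i = W.1 i := by
  simp [graft, mkRN, hi]

theorem graft_ge (W : RN N) (n : ℕ) (Z : RN N) (d : ℕ) (h) {i : ℕ} (hi : n ≤ i) :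
    (graft W n Z d h).1 i = Z.1 (d + (i - n)) := by
  simp [graft, mkRN, Nat.not_lt.2 hi]

theorem mem_EB {b : List (CreatureN N)} {Y Z : RN N} : Z ∈ EBasicN N b Y ↔
    leN N Z.1 Y.1 ∧ restrN N Z.1 b.length = b := Iff.rfl

theorem restr_eq_iff {Y Z : RN N} {k : ℕ} :
    restrN N Y.1 k = restrN N Z.1 k ↔ ∀ i < k, Y.1 i = Z.1 i := by
  unfold restrN
  rw [List.ofFn_inj]
  constructor
  · intro h i hi
    exact congrFun h ⟨i, hi⟩
  · intro h
    funext i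
    exact h i.1 i.2

theorem restr_length (Y : RN N) (k : ℕ) : (restrN N Y.1 k).length = k := by
  simp [restrN]

theorem mem_EB_restr {Y X Z : RN N} {k : ℕ} : Z ∈ EBasicN N (restrN N X.1 k) Y ↔
    leN N Z.1 Y.1 ∧ ∀ i < k, Z.1 i = X.1 i := by
  rw [mem_EB, restr_length, restr_eq_iff]

theorem EB_mono {b : List (CreatureN N)} {Y Z : RN N} (h : leN N Z.1 Y.1) :
    EBasicN N b Z ⊆ EBasicN N b Y := fun _ hW => ⟨leN_trans hW.1 h, hW.2⟩

def Bk (k : ℕ) (Y : RN N) : Set (RN N) := {Z | leN N Z.1 Y.1 ∧ ∀ i < k, Z.1 i = Y.1 i}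

theorem Bk_eq (k : ℕ) (Y : RN N) : EBasicN N (restrN N Y.1 k) Y = Bk k Y := by
  ext Z; exact mem_EB_restr

theorem Bk_self (k : ℕ) (Y : RN N) : Y ∈ Bk k Y := ⟨leN_refl Y, fun _ _ => rfl⟩

theorem Bk_trans {k : ℕ} {X Y Z : RN N} (h1 : Z ∈ Bk k Y) (h2 : Y ∈ Bk k X) : Z ∈ Bk k X :=
  ⟨leN_trans h1.1 h2.1, fun i hi => (h1.2 i hi).trans (h2.2 i hi)⟩

theorem Bk_anti {k m : ℕ} (hkm : k ≤ m) {Y Z : RN N} (h1 : Z ∈ Bk m Y) : Z ∈ Bk k Y :=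
  ⟨h1.1, fun i hi => h1.2 i (by omega)⟩

def Dep (Y : RN N) (b : List (CreatureN N)) (d : ℕ) : Prop :=
  ∃ W ∈ EBasicN N b Y, (b = [] ∧ d = 0) ∨ (b ≠ [] ∧ (W.1 b.length).mdn = (Y.1 d).mdn)

theorem mdn_of_agree {Y Z : RN N} {k : ℕ} (h : ∀ i < k, Z.1 i = Y.1 i) (hk : 0 < k) :
    (Z.1 k).mdn = (Y.1 k).mdn := by
  obtain ⟨m, rfl⟩ : ∃ m, k = m + 1 := ⟨k - 1, by omega⟩
  rw [← rn_mup, ← rn_mup, h m (by omega)]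

theorem dep_exists {Y : RN N} {b : List (CreatureN N)} (h : (EBasicN N b Y).Nonempty) :
    ∃ d, Dep Y b d := by
  obtain ⟨W, hW⟩ := h
  by_cases hb : b = []
  · exact ⟨0, W, hW, Or.inl ⟨hb, rfl⟩⟩
  · obtain ⟨d, hd⟩ := ((le_iff _ _).1 hW.1 b.length).1
    exact ⟨d, W, hW, Or.inr ⟨hb, hd⟩⟩

theorem dep_mono {Y Z : RN N} {b : List (CreatureN N)} {d : ℕ} (h : Dep Y b d) (hZ : Z ∈ Bk d Y) :
    Dep Z b d := by
  obtain ⟨W, hW, (⟨hb, hd⟩ | ⟨hb, hd⟩)⟩ := h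
  · subst hb
    refine ⟨Z, ⟨leN_refl Z, ?_⟩, Or.inl ⟨rfl, hd⟩⟩
    simp [restrN]
  · have hn : 0 < b.length := List.length_pos_iff.2 hb
    have hWY := (le_iff _ _).1 hW.1
    have hd0 : 0 < d := by
      obtain ⟨a, ha⟩ := (hWY 0).1
      have : (W.1 0).mdn < (W.1 b.length).mdn := (rn_lt W).2 hn
      rw [ha, hd, rn_lt] at this
      omega
    have hdd := mdn_of_agree hZ.2 hd0
    have hg : b.length = 0 ∨ (W.1 b.length).mdn = (Z.1 d).mdn := Or.inr (by rw [hd, hdd])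
    refine ⟨graft W b.length Z d hg, ⟨?_, ?_⟩, Or.inr ⟨hb, ?_⟩⟩
    · rw [le_iff]
      intro i
      by_cases hi : i < b.length
      · rw [graft_lt _ _ _ _ _ hi]
        refine bel_transfer (hWY i) ?_
        intro l h1 h2
        refine ⟨l, hZ.2 l ?_⟩
        rw [← rn_lt Y, ← hd]
        refine lt_of_lt_of_le h2 ?_
        rw [rn_mup, rn_le]; exact hi
      · rw [graft_ge _ _ _ _ _ (Nat.not_lt.1 hi)]
        exact bel_self _ _
    · conv_rhs => rw [← hW.2]
      rw [restr_eq_iff]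
      intro i hi
      rw [graft_lt _ _ _ _ _ hi]
    · rw [graft_ge _ _ _ _ _ le_rfl]; simp

theorem dep_nonempty {Y : RN N} {b : List (CreatureN N)} {d : ℕ} (h : Dep Y b d) :
    (EBasicN N b Y).Nonempty := ⟨h.choose, h.choose_spec.1⟩

theorem amalg {Y Z : RN N} {b : List (CreatureN N)} {d : ℕ} (h : Dep Y b d) (hZY : leN N Z.1 Y.1)
    (hne : (EBasicN N b Z).Nonempty) : ∃ Z' ∈ Bk d Y, EBasicN N b Z' ⊆ EBasicN N b Z := by
  obtain ⟨W, hW, (⟨hb, hd⟩ | ⟨hb, hd⟩)⟩ := h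
  · subst hd
    exact ⟨Z, ⟨hZY, by simp⟩, subset_rfl⟩
  · have hn : 0 < b.length := List.length_pos_iff.2 hb
    obtain ⟨V, hV⟩ := hne
    have hVZ := (le_iff _ _).1 hV.1
    obtain ⟨e, he⟩ := (hVZ b.length).1
    have hVW : ∀ i < b.length, V.1 i = W.1 i := restr_eq_iff.1 (hV.2.trans hW.2.symm)
    have hde : (Y.1 d).mdn = (Z.1 e).mdn := by
      rw [← hd, ← he, mdn_of_agree hVW hn]
    refine ⟨graft Y d Z e (Or.inr hde), ⟨?_, ?_⟩, ?_⟩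
    · rw [le_iff]
      intro i
      by_cases hi : i < d
      · rw [graft_lt _ _ _ _ _ hi]; exact bel_self _ _
      · rw [graft_ge _ _ _ _ _ (Nat.not_lt.1 hi)]; exact (le_iff _ _).1 hZY _
    · intro i hi; rw [graft_lt _ _ _ _ _ hi]
    · intro U hU
      refine ⟨?_, hU.2⟩
      have hUV : ∀ i < b.length, U.1 i = V.1 i := restr_eq_iff.1 (hU.2.trans hV.2.symm)
      rw [le_iff]
      intro i
      by_cases hi : i < b.length
      · rw [hUV i hi]; exact hVZ i
      · refine bel_transfer ((le_iff _ _).1 hU.1 i) ?_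
        intro l h1 h2
        have hl : d ≤ l := by
          rw [← rn_le (graft Y d Z e (Or.inr hde)), graft_ge _ _ _ _ _ le_rfl]
          simp only [Nat.sub_self, Nat.add_zero]
          refine le_trans ?_ h1
          have e1 : (Z.1 e).mdn = (U.1 b.length).mdn := by
            rw [← he, ← mdn_of_agree hUV hn]
          refine le_trans e1.le ?_
          rw [rn_le]; omega
        rw [graft_ge _ _ _ _ _ hl]
        exact ⟨_, rfl⟩

theorem dep_self (Y : RN N) (k : ℕ) : Dep Y (restrN N Y.1 k) k := by
  refine ⟨Y, mem_EB_restr.2 ⟨leN_refl Y, fun _ _ => rfl⟩, ?_⟩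
  by_cases hk : k = 0
  · left; subst hk; simp [restrN]
  · right
    rw [restr_length]
    refine ⟨?_, rfl⟩
    intro h
    have := congrArg List.length h
    rw [restr_length] at this
    simp at this; exact hk this

theorem dep_of_le {Y W : RN N} (h : leN N W.1 Y.1) (n : ℕ) :
    ∃ d, n ≤ d ∧ Dep Y (restrN N W.1 n) d := by
  by_cases hn : n = 0
  · subst hn
    exact ⟨0, le_rfl, W, mem_EB_restr.2 ⟨h, by simp⟩, Or.inl ⟨by simp [restrN], rfl⟩⟩
  · obtain ⟨j, hj, hs⟩ := id h
    refine ⟨j n, hj.le_apply, W, mem_EB_restr.2 ⟨h, fun _ _ => rfl⟩, Or.inr ⟨?_, ?_⟩⟩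
    · intro h
      have := congrArg List.length h
      rw [restr_length] at this
      simp at this; exact hn this
    · rw [restr_length]; exact (hs n).1

theorem creature_finite (M : ℕ) : {c : CreatureN N | c.mup ≤ M}.Finite := by
  let f : CreatureN N → ℕ × ℕ × (Fin M → Option ℕ) := fun c => (c.mdn, c.mup, fun i => c.phi i)
  have hT : (Set.Iic M ×ˢ (Set.Iic M ×ˢ
      (Set.univ.pi fun _ : Fin M => (insert none (some '' Set.Iio N) : Set (Option ℕ))))).Finite := by
    refine (Set.finite_Iic M).prod ((Set.finite_Iic M).prod ?_)
    exact Set.Finite.pi fun _ => ((Set.finite_Iio N).image _).insert _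
  refine Set.Finite.of_finite_image (f := f) (hT.subset ?_) ?_
  · rintro _ ⟨c, hc, rfl⟩
    refine ⟨?_, hc, ?_⟩
    · exact le_trans c.hm.le hc
    · intro i _
      change c.phi i ∈ _
      cases hcp : c.phi i with
      | none => exact Or.inl rfl
      | some a => exact Or.inr ⟨a, c.hran _ _ hcp, rfl⟩
  · intro c hc d hd hcd
    simp only [f, Prod.mk.injEq] at hcd
    refine cre_ext hcd.1 hcd.2.1 fun j => ?_
    by_cases hj : j < M
    · exact congrFun hcd.2.2 ⟨j, hj⟩
    · have aux : ∀ c : CreatureN N, c.mup ≤ M → c.phi j = none := by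
        intro c hc
        apply phi_none
        intro h
        have := c.hX.1 h
        rw [Finset.mem_Ico] at this
        omega
      rw [aux c hc, aux d hd]

theorem dep_finite (Y : RN N) (d : ℕ) : {b | Dep Y b d}.Finite := by
  have hfin := creature_finite (N := N) (Y.1 d).mdn
  set S := {c : CreatureN N | c.mup ≤ (Y.1 d).mdn} with hS
  have : Finite S := hfin
  have h2 : {l : List S | l.length ≤ (Y.1 d).mdn}.Finite := List.finite_length_le S _
  refine (h2.image (List.map Subtype.val)).subset ?_
  rintro b ⟨W, hW, (⟨hb, hd⟩ | ⟨hb, hd⟩)⟩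
  · subst hb; exact ⟨[], by simp, rfl⟩
  · have hlen : b.length ≤ (Y.1 d).mdn := by
      rw [← hd]; exact (rn_mono W).le_apply
    have hmem : ∀ c ∈ b, c ∈ S := by
      intro c hc
      rw [← hW.2] at hc
      unfold restrN at hc
      rw [List.mem_ofFn] at hc
      obtain ⟨i, rfl⟩ := hc
      change (W.1 i).mup ≤ _
      rw [rn_mup, ← hd, rn_le]
      exact i.2
    refine ⟨b.attach.map (fun c => ⟨c.1, hmem c.1 c.2⟩), ?_, ?_⟩
    · simpa using hlen
    · simp

theorem fusion (k : ℕ) (X : RN N) (D : List (CreatureN N) → RN N → Prop)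
    (hered : ∀ b Y Z, leN N Z.1 Y.1 → D b Y → D b Z)
    (dense : ∀ b Y d, Y ∈ Bk k X → k ≤ d → Dep Y b d → ∃ Z ∈ Bk d Y, D b Z) :
    ∃ Y ∈ Bk k X, ∀ d, k ≤ d → ∀ b, Dep Y b d → D b Y := by
  have step : ∀ (Y : RN N) (d : ℕ), ∃ Z ∈ Bk d Y,
      Y ∈ Bk k X → k ≤ d → ∀ b, Dep Y b d → D b Z := by
    intro Y d
    by_cases hYk : Y ∈ Bk k X ∧ k ≤ d
    swap
    · exact ⟨Y, Bk_self _ _, fun h1 h2 => absurd ⟨h1, h2⟩ hYk⟩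
    have aux : ∀ F : Set (List (CreatureN N)), F.Finite → (∀ b ∈ F, Dep Y b d) →
        ∃ Z ∈ Bk d Y, ∀ b ∈ F, D b Z := by
      intro F hF
      induction F, hF using Set.Finite.induction_on with
      | empty => exact fun _ => ⟨Y, Bk_self _ _, by simp⟩
      | @insert b F hb hF ih =>
        intro h
        obtain ⟨Z, hZ, hZF⟩ := ih (fun c hc => h c (Set.mem_insert_of_mem _ hc))
        obtain ⟨Z', hZ', hD⟩ := dense b Z d (Bk_trans (Bk_anti hYk.2 hZ) hYk.1) hYk.2 (dep_mono (h b (Set.mem_insert _ _)) hZ)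
        refine ⟨Z', Bk_trans hZ' hZ, ?_⟩
        intro c hc
        rcases hc with rfl | hc
        · exact hD
        · exact hered _ _ _ hZ'.1 (hZF c hc)
    obtain ⟨Z, hZ, h⟩ := aux _ (dep_finite Y d) fun b hb => hb
    exact ⟨Z, hZ, fun _ _ => h⟩
  choose st hst1 hst2 using step
  let S : ℕ → RN N := fun n => Nat.rec X (fun n Y => st Y (k + n)) n
  have hS : ∀ n, S (n + 1) = st (S n) (k + n) := fun n => rfl
  have hB : ∀ n m, S (n + m) ∈ Bk (k + n) (S n) := by
    intro n m
    induction m with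
    | zero => exact Bk_self _ _
    | succ m ih =>
      rw [← Nat.add_assoc, hS]
      exact Bk_trans (Bk_anti (by omega) (hst1 (S (n + m)) (k + (n + m)))) ih
  have hB' : ∀ n m, n ≤ m → S m ∈ Bk (k + n) (S n) := by
    intro n m h
    obtain ⟨r, rfl⟩ := Nat.exists_eq_add_of_le h
    exact hB n r
  let Y : RN N := mkRN (fun i => (S (i + 1)).1 i) (by
    intro i
    rw [← (hB' (i + 1) (i + 1 + 1) (by omega)).2 i (by omega)]
    exact rn_mup _ _)
  have hYi : ∀ n i, i < k + n → Y.1 i = (S n).1 i := by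
    intro n i hi
    change (S (i + 1)).1 i = _
    rcases le_total n (i + 1) with h | h
    · exact (hB' n (i + 1) h).2 i hi
    · exact ((hB' (i + 1) n h).2 i (by omega)).symm
  have hY : ∀ n, Y ∈ Bk (k + n) (S n) := by
    intro n
    refine ⟨?_, hYi n⟩
    rw [le_iff]
    intro i
    by_cases hi : i < k + n
    · rw [hYi n i hi]; exact bel_self _ _
    · exact (le_iff _ _).1 (hB' n (i + 1) (by omega)).1 i
  refine ⟨Y, hY 0, ?_⟩
  intro d hd b hb
  obtain ⟨n, rfl⟩ := Nat.exists_eq_add_of_le hd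
  refine hered b (S (n + 1)) Y (hY (n + 1)).1 ?_
  rw [hS]
  refine hst2 (S n) (k + n) (Bk_anti (by omega) (hB' 0 n (Nat.zero_le n))) (by omega) b ?_
  obtain ⟨W, hW, h⟩ := hb
  refine ⟨W, EB_mono (hY n).1 hW, ?_⟩
  rcases h with h | ⟨h, h'⟩
  · exact Or.inl h
  · refine Or.inr ⟨h, ?_⟩
    rw [h']
    refine mdn_of_agree (hY n).2 ?_
    obtain ⟨a, ha⟩ := ((le_iff _ _).1 hW.1 0).1
    have : (W.1 0).mdn < (W.1 b.length).mdn := (rn_lt W).2 (List.length_pos_iff.2 h)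
    rw [ha, h', rn_lt] at this
    omega

end Basics
section Pigeon
variable {N : ℕ}

theorem LR_comp {s t u : CreatureN N} (hs : Finset.Ico s.mdn s.mup ⊆ Finset.Ico t.mdn t.mup)
    {o o' : Option (Fin N)} (a : LR s t o) (b : LR t u o') : LR s u (o.or o') := by
  intro j hj
  rw [b j (hs hj), a j hj, Option.or_assoc]
  cases o <;> simp

def WRep (Y : RN N) (d : ℕ) (w : List (Option (Fin N))) (c : CreatureN N) : Prop :=
  c.mdn = (Y.1 d).mdn ∧ c.mup = (Y.1 (d + w.length)).mdn ∧
    ∀ i o, w[i]? = some o → LR (Y.1 (d + i)) c o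

theorem locate_rep {Y : RN N} {d n x : ℕ} (h1 : (Y.1 d).mdn ≤ x) (h2 : x < (Y.1 (d + n)).mdn) :
    ∃ i < n, x ∈ Finset.Ico (Y.1 (d + i)).mdn (Y.1 (d + i)).mup := by
  obtain ⟨l, hl1, hl2⟩ := rn_locate Y x (le_trans ((rn_le Y).2 (Nat.zero_le d)) h1)
  have a1 := lt_of_le_of_lt h1 hl2
  have a2 := lt_of_le_of_lt hl1 h2
  rw [rn_lt] at a1 a2
  obtain ⟨i, rfl⟩ := Nat.exists_eq_add_of_le (Nat.le_of_lt_succ a1)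
  refine ⟨i, by omega, ?_⟩
  rw [Finset.mem_Ico, rn_mup]
  exact ⟨hl1, hl2⟩

theorem getElem_some {α : Type*} (w : List α) {i : ℕ} (h : i < w.length) :
    ∃ o, w[i]? = some o := ⟨w[i], List.getElem?_eq_getElem h⟩

theorem phi_out (c : CreatureN N) {j : ℕ} (h : ¬ (c.mdn ≤ j ∧ j < c.mup)) : c.phi j = none := by
  apply phi_none
  intro hj
  exact h (Finset.mem_Ico.1 (c.hX.1 hj))

theorem rep_unique {Y : RN N} {d : ℕ} {w : List (Option (Fin N))} {c c' : CreatureN N}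
    (h : WRep Y d w c) (h' : WRep Y d w c') : c = c' := by
  refine cre_ext (h.1.trans h'.1.symm) (h.2.1.trans h'.2.1.symm) fun j => ?_
  by_cases hj : (Y.1 d).mdn ≤ j ∧ j < (Y.1 (d + w.length)).mdn
  · obtain ⟨i, hi, hji⟩ := locate_rep hj.1 hj.2
    obtain ⟨o, ho⟩ := getElem_some w hi
    rw [h.2.2 i o ho j hji, h'.2.2 i o ho j hji]
  · rw [phi_out c (by rw [h.1, h.2.1]; exact hj), phi_out c' (by rw [h'.1, h'.2.1]; exact hj)]

theorem rep_var {Y : RN N} {d : ℕ} {w : List (Option (Fin N))} {c : CreatureN N}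
    (h : WRep Y d w c) : none ∈ w := by
  obtain ⟨x, hxI, hx⟩ := Finset.exists_of_ssubset c.hX
  rw [Finset.mem_Ico, h.1, h.2.1] at hxI
  obtain ⟨i, hi, hji⟩ := locate_rep hxI.1 hxI.2
  obtain ⟨o, ho⟩ := getElem_some w hi
  have := h.2.2 i o ho x hji
  rw [phi_none c hx] at this
  have h2 := (Option.or_eq_none_iff.1 this.symm).2
  rw [Option.map_eq_none_iff] at h2
  subst h2
  exact List.mem_of_getElem? ho

theorem rep_exists (Y : RN N) (d : ℕ) (w : List (Option (Fin N))) (hw : none ∈ w) :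
    ∃ c, WRep Y d w c := by
  classical
  have hidx : ∀ x, ∃ i, ((Y.1 d).mdn ≤ x ∧ x < (Y.1 (d + w.length)).mdn) →
      i < w.length ∧ x ∈ Finset.Ico (Y.1 (d + i)).mdn (Y.1 (d + i)).mup := by
    intro x
    by_cases h : (Y.1 d).mdn ≤ x ∧ x < (Y.1 (d + w.length)).mdn
    · obtain ⟨i, hi⟩ := locate_rep h.1 h.2
      exact ⟨i, fun _ => hi⟩
    · exact ⟨0, fun h' => absurd h' h⟩
  choose idx hidx using hidx
  let phi : ℕ → Option ℕ := fun j =>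
    if (Y.1 d).mdn ≤ j ∧ j < (Y.1 (d + w.length)).mdn then
      ((Y.1 (d + idx j)).phi j).or ((w[idx j]?.getD none).map Fin.val) else none
  have huniq : ∀ i j, i < w.length → j ∈ Finset.Ico (Y.1 (d + i)).mdn (Y.1 (d + i)).mup →
      ((Y.1 d).mdn ≤ j ∧ j < (Y.1 (d + w.length)).mdn) ∧ idx j = i := by
    intro i j hi hj
    rw [Finset.mem_Ico, rn_mup] at hj
    have h1 : (Y.1 d).mdn ≤ j ∧ j < (Y.1 (d + w.length)).mdn :=
      ⟨le_trans ((rn_le Y).2 (by omega)) hj.1, lt_of_lt_of_le hj.2 ((rn_le Y).2 (by omega))⟩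
    refine ⟨h1, ?_⟩
    have h2 := (hidx j h1).2
    rw [Finset.mem_Ico, rn_mup] at h2
    have a := lt_of_le_of_lt hj.1 h2.2
    have b := lt_of_le_of_lt h2.1 hj.2
    rw [rn_lt] at a b
    omega
  have hphi : ∀ i o, w[i]? = some o → ∀ j ∈ Finset.Ico (Y.1 (d + i)).mdn (Y.1 (d + i)).mup,
      phi j = ((Y.1 (d + i)).phi j).or (o.map Fin.val) := by
    intro i o ho j hj
    obtain ⟨hi, _⟩ := List.getElem?_eq_some_iff.1 ho
    obtain ⟨h1, h2⟩ := huniq i j hi hj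
    simp only [phi, if_pos h1, h2, ho, Option.getD_some]
  obtain ⟨i0, hi0⟩ := List.mem_iff_getElem?.1 hw
  obtain ⟨hi0l, _⟩ := List.getElem?_eq_some_iff.1 hi0
  have hlen : 0 < w.length := by omega
  refine ⟨{ mdn := (Y.1 d).mdn, mup := (Y.1 (d + w.length)).mdn,
            hm := (rn_lt Y).2 (by omega),
            X := (Finset.Ico (Y.1 d).mdn (Y.1 (d + w.length)).mdn).filter
              (fun j => (phi j).isSome),
            hX := ?_, phi := phi, hdom := ?_, hran := ?_ }, rfl, rfl, hphi⟩
  · obtain ⟨x, hxI, hx⟩ := Finset.exists_of_ssubset (Y.1 (d + i0)).hX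
    refine Finset.filter_ssubset.2 ⟨x, ?_, ?_⟩
    · rw [Finset.mem_Ico]; exact (huniq i0 x hi0l hxI).1
    · rw [hphi i0 none hi0 x hxI, phi_none _ hx]; simp
  · intro j
    rw [Finset.mem_filter, Finset.mem_Ico]
    constructor
    · intro h
      refine ⟨?_, h⟩
      by_contra hc
      simp only [phi, if_neg hc] at h
      simp at h
    · exact fun h => h.2
  · intro j a ha
    by_cases hc : (Y.1 d).mdn ≤ j ∧ j < (Y.1 (d + w.length)).mdn
    · simp only [phi, if_pos hc] at ha
      rw [Option.or_eq_some_iff] at ha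
      rcases ha with ha | ⟨_, ha⟩
      · exact (Y.1 (d + idx j)).hran j a ha
      · rw [Option.map_eq_some_iff] at ha
        obtain ⟨b, _, rfl⟩ := ha
        exact b.2
    · simp only [phi, if_neg hc] at ha
      simp at ha

theorem rep_bel {Y : RN N} {d : ℕ} {w : List (Option (Fin N))} {c : CreatureN N}
    (h : WRep Y d w c) (hp : ∀ (i : ℕ) (a : Fin N), w[i]? = some (some a) →
      ∃ i' ≠ i, ∃ a', w[i']? = some (some a')) : Bel Y c := by
  refine ⟨⟨_, h.1⟩, ⟨_, h.2.1⟩, ?_⟩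
  intro l h1 h2
  rw [h.1, rn_le] at h1
  rw [h.2.1, rn_lt] at h2
  obtain ⟨i, rfl⟩ := Nat.exists_eq_add_of_le h1
  obtain ⟨o, ho⟩ := getElem_some w (i := i) (by omega)
  have hLR := h.2.2 i o ho
  have aux : ∀ (i : ℕ) (a : Fin N), w[i]? = some (some a) →
      Finset.Ico (Y.1 (d + i)).mdn (Y.1 (d + i)).mup ⊆ c.X := by
    intro i a ha j hj
    rw [← c.hdom, h.2.2 i _ ha j hj]
    simp
  cases o with
  | none => exact Or.inl hLR
  | some a =>
    refine Or.inr ⟨⟨a, hLR⟩, ?_⟩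
    obtain ⟨i', hi', a', ha'⟩ := hp i a ho
    rw [Finset.ssubset_iff_of_subset (aux i a ho)]
    refine ⟨(Y.1 (d + i')).mdn, aux i' a' ha' (Finset.mem_Ico.2 ⟨le_rfl, (Y.1 (d + i')).hm⟩), ?_⟩
    rw [Finset.mem_Ico, rn_mup, rn_le, rn_lt]
    omega

theorem bel_rep {Y : RN N} {d : ℕ} {c : CreatureN N} (h : Bel Y c) (hd : c.mdn = (Y.1 d).mdn) :
    ∃ w, WRep Y d w c := by
  obtain ⟨_, ⟨b, hb⟩, h3⟩ := h
  have hdb : d < b := by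
    have := c.hm
    rwa [hd, hb, rn_lt] at this
  have : ∀ i : Fin (b - d), ∃ o, LR (Y.1 (d + i)) c o := by
    intro i
    rcases h3 (d + i) (by rw [hd, rn_le]; omega) (by rw [hb, rn_lt]; omega) with h | ⟨⟨a, h⟩, _⟩
    · exact ⟨_, h⟩
    · exact ⟨_, h⟩
  choose o ho using this
  refine ⟨List.ofFn o, hd, ?_, ?_⟩
  · rw [List.length_ofFn, hb]
    rw [show d + (b - d) = b by omega]
  · intro i o' h
    rw [List.getElem?_ofFn] at h
    split_ifs at h with hi
    simp only [Option.some.injEq] at h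
    rw [← h]
    exact ho ⟨i, hi⟩

theorem count_two (w : List (Option (Fin N))) : ∀ (i : ℕ), 2 ≤ w.countP (·.isSome) →
    ∃ i' ≠ i, ∃ a', w[i']? = some (some a') := by
  induction w with
  | nil => intro i h; simp at h
  | cons x t ih =>
    intro i h
    rw [List.countP_cons] at h
    cases i with
    | zero =>
      have : 0 < t.countP (·.isSome) := by
        split_ifs at h <;> omega
      rw [List.countP_pos_iff] at this
      obtain ⟨o, ho, hs⟩ := this
      obtain ⟨i, hi⟩ := List.mem_iff_getElem?.1 ho
      obtain ⟨a, rfl⟩ := Option.isSome_iff_exists.1 hs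
      exact ⟨i + 1, by omega, a, by simpa using hi⟩
    | succ k =>
      cases x with
      | some a => exact ⟨0, by omega, a, by simp⟩
      | none =>
        obtain ⟨i', h1, a', h2⟩ := ih k (by simpa using h)
        exact ⟨i' + 1, by omega, a', by simpa using h2⟩

def posW (w : ℕ → List (Option (Fin N))) : ℕ → ℕ
  | 0 => 0
  | k + 1 => posW w k + (w k).length

theorem flatW_length (w : ℕ → List (Option (Fin N))) (u : ℕ → Option (Fin N)) (k : ℕ) :
    (flatW w u k).length = posW w k := by
  induction k with
  | zero => rfl
  | succ k ih => simp [flatW, posW, ih, subW]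

def HomC (P : CreatureN N → Prop) (Z : RN N) (m : ℕ) : Prop :=
  (∀ c, Bel Z c → c.mdn = m → P c) ∨ (∀ c, Bel Z c → c.mdn = m → ¬ P c)

theorem core (hN : 0 < N) (Y : RN N) (d : ℕ) (P : CreatureN N → Prop) :
    ∃ Z ∈ Bk d Y, HomC P Z (Y.1 d).mdn := by
  obtain ⟨w, hw, hA⟩ := exists_words hN {v | ∃ c, WRep Y d v c ∧ P c}
  have hz : ∀ i, ∃ c, WRep Y (d + posW w i) (w i) c := fun i => rep_exists _ _ _ (hw i).1
  choose z hz using hz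
  have hzmup : ∀ i, (z i).mup = (Y.1 (d + posW w (i + 1))).mdn := by
    intro i
    rw [(hz i).2.1, posW, Nat.add_assoc]
  let Z' : RN N := mkRN z (by
    intro i
    rw [hzmup, (hz (i + 1)).1])
  have hg : (Y.1 d).mdn = (Z'.1 0).mdn := by
    change _ = (z 0).mdn
    rw [(hz 0).1]; rfl
  have hZ1 : ∀ i, i < d → (graft Y d Z' 0 (Or.inr hg)).1 i = Y.1 i := fun i hi =>
    graft_lt _ _ _ _ _ hi
  have hZ2 : ∀ i, (graft Y d Z' 0 (Or.inr hg)).1 (d + i) = z i := by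
    intro i
    rw [graft_ge _ _ _ _ _ (by omega)]
    change z _ = _
    congr 1; omega
  generalize graft Y d Z' 0 (Or.inr hg) = Z at hZ1 hZ2
  have hbz : ∀ i, Bel Y (z i) := fun i => rep_bel (hz i) fun j a _ => count_two (w i) j (hw i).2
  refine ⟨Z, ⟨?_, hZ1⟩, ?_⟩
  · rw [le_iff]
    intro i
    by_cases hi : i < d
    · rw [hZ1 i hi]; exact bel_self _ _
    · obtain ⟨r, rfl⟩ := Nat.exists_eq_add_of_le (Nat.not_lt.1 hi)
      rw [hZ2]; exact hbz r
  · have hd : (Z.1 d).mdn = (Y.1 d).mdn := by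
      have := hZ2 0
      rw [Nat.add_zero] at this
      rw [this, (hz 0).1]; rfl
    have key : ∀ c, Bel Z c → c.mdn = (Y.1 d).mdn → ∃ k u, WRep Y d (flatW w u k) c := by
      intro c hc hcd
      obtain ⟨u, hu⟩ := bel_rep hc (hcd.trans hd.symm)
      refine ⟨u.length, fun i => u[i]?.getD none, hcd, ?_, ?_⟩
      · rw [hu.2.1, hZ2, (hz _).1, flatW_length]
      · have : ∀ k ≤ u.length, ∀ i o, (flatW w (fun i => u[i]?.getD none) k)[i]? = some o →
            LR (Y.1 (d + i)) c o := by
          intro k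
          induction k with
          | zero => intro _ i o h; simp [flatW] at h
          | succ k ih =>
            intro hk i o h
            rw [flatW] at h
            by_cases hi : i < (flatW w (fun i => u[i]?.getD none) k).length
            · rw [List.getElem?_append_left hi] at h
              exact ih (by omega) i o h
            · rw [List.getElem?_append_right (by omega), subW, List.getElem?_map,
                Option.map_eq_some_iff] at h
              rw [flatW_length] at hi h
              obtain ⟨o1, ho1, rfl⟩ := h
              obtain ⟨u1, hu1⟩ := getElem_some u (i := k) (by omega)
              have hl := hu.2.2 k u1 hu1
              rw [hZ2] at hl
              have hr := (hz k).2.2 _ _ ho1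
              obtain ⟨hlt, _⟩ := List.getElem?_eq_some_iff.1 ho1
              rw [show d + posW w k + (i - posW w k) = d + i by omega] at hr
              simp only [hu1, Option.getD_some]
              refine LR_comp ?_ hr hl
              apply Finset.Ico_subset_Ico
              · rw [(hz k).1, rn_le]; omega
              · rw [(hz k).2.1, rn_mup, rn_le]; omega
        exact this _ le_rfl
    rcases hA with hA | hA
    · left
      intro c hc hcd
      obtain ⟨k, u, hR⟩ := key c hc hcd
      obtain ⟨c', hR', hP⟩ := hA k u (rep_var hR)
      rw [rep_unique hR hR']; exact hP
    · right
      intro c hc hcd hP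
      obtain ⟨k, u, hR⟩ := key c hc hcd
      exact hA k u (rep_var hR) ⟨c, hR, hP⟩

theorem free_core (hN : 0 < N) (Y : RN N) (P : CreatureN N → Prop) :
    ∃ Z : RN N, leN N Z.1 Y.1 ∧ ((∀ c, Bel Z c → P c) ∨ (∀ c, Bel Z c → ¬ P c)) := by
  obtain ⟨Y', hY', hD⟩ := fusion 0 Y
    (fun b Z => ∀ W : RN N, b ≠ [] → restrN N W.1 b.length = b → HomC P Z (W.1 b.length).mdn)
    (by
      intro b Y Z hle h W hb hW
      have hle' := (le_iff _ _).1 hle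
      rcases h W hb hW with h | h
      · exact Or.inl fun c hc => h c (bel_trans hle' hc)
      · exact Or.inr fun c hc => h c (bel_trans hle' hc))
    (by
      rintro b Y d - - ⟨W0, hW0, (⟨hb, hd⟩ | ⟨hb, hd⟩)⟩
      · exact ⟨Y, Bk_self _ _, fun W h => absurd hb h⟩
      · obtain ⟨Z, hZ, hH⟩ := core hN Y d P
        refine ⟨Z, hZ, fun W _ hW => ?_⟩
        rw [mdn_of_agree (restr_eq_iff.1 (hW.trans hW0.2.symm)) (List.length_pos_iff.2 hb), hd]
        exact hH)
  have hH : ∀ d, 0 < d → HomC P Y' (Y'.1 d).mdn := by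
    intro d hd
    have := hD d (Nat.zero_le _) _ (dep_self Y' d) Y'
    rw [restr_length] at this
    refine this ?_ rfl
    intro h
    have := congrArg List.length h
    rw [restr_length] at this
    simp at this; omega
  have merge : ∀ Q : CreatureN N → Prop,
      (∃ᶠ d in atTop, ∀ c, Bel Y' c → c.mdn = (Y'.1 d).mdn → Q c) →
      ∃ Z : RN N, leN N Z.1 Y.1 ∧ ∀ c, Bel Z c → Q c := by
    intro Q hQ
    obtain ⟨φ, hφ, hφQ⟩ := Filter.extraction_of_frequently_atTop hQ
    have hlt : ∀ n, φ n < φ (n + 1) := fun n => hφ (Nat.lt_succ_self n)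
    have hz : ∀ n, ∃ c, WRep Y' (φ n) (List.replicate (φ (n + 1) - φ n) none) c := by
      intro n
      refine rep_exists _ _ _ ?_
      rw [List.mem_replicate]
      have := hlt n
      exact ⟨by omega, rfl⟩
    choose z hz using hz
    let Z : RN N := mkRN z (by
      intro n
      rw [(hz n).2.1, (hz (n + 1)).1, List.length_replicate]
      have := hlt n
      rw [show φ n + (φ (n + 1) - φ n) = φ (n + 1) by omega])
    have hZ : ∀ n, Bel Y' (Z.1 n) := by
      intro n
      refine rep_bel (hz n) ?_
      intro i a h
      rw [List.getElem?_replicate] at h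
      split_ifs at h
      simp at h
    refine ⟨Z, leN_trans ((le_iff _ _).2 hZ) hY'.1, ?_⟩
    intro c hc
    obtain ⟨a, ha⟩ := hc.1
    refine hφQ a c (bel_trans hZ hc) ?_
    rw [ha]; exact (hz a).1
  by_cases hf : ∃ᶠ d in atTop, ∀ c, Bel Y' c → c.mdn = (Y'.1 d).mdn → P c
  · obtain ⟨Z, h1, h2⟩ := merge P hf
    exact ⟨Z, h1, Or.inl h2⟩
  · obtain ⟨Z, h1, h2⟩ := merge (fun c => ¬ P c) (by
      rw [Filter.not_frequently] at hf
      refine Filter.Eventually.frequently ?_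
      filter_upwards [hf, Filter.eventually_gt_atTop 0] with d hd hd0
      rcases hH d hd0 with h | h
      · exact absurd h hd
      · exact h)
    exact ⟨Z, h1, Or.inr h2⟩

theorem pigeon (hN : 0 < N) {Y : RN N} {b : List (CreatureN N)} {d : ℕ} (h : Dep Y b d)
    (P : CreatureN N → Prop) : ∃ Z ∈ Bk d Y, (∀ V ∈ EBasicN N b Z, P (V.1 b.length)) ∨
      (∀ V ∈ EBasicN N b Z, ¬ P (V.1 b.length)) := by
  obtain ⟨W, hW, (⟨hb, hd⟩ | ⟨hb, hd⟩)⟩ := h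
  · subst hd
    obtain ⟨Z, h1, h2⟩ := free_core hN Y P
    refine ⟨Z, ⟨h1, by simp⟩, ?_⟩
    rcases h2 with h2 | h2
    · exact Or.inl fun V hV => h2 _ ((le_iff _ _).1 hV.1 _)
    · exact Or.inr fun V hV => h2 _ ((le_iff _ _).1 hV.1 _)
  · obtain ⟨Z, hZ, hH⟩ := core hN Y d P
    refine ⟨Z, hZ, ?_⟩
    have aux : ∀ V ∈ EBasicN N b Z, (V.1 b.length).mdn = (Y.1 d).mdn := by
      intro V hV
      rw [mdn_of_agree (restr_eq_iff.1 (hV.2.trans hW.2.symm)) (List.length_pos_iff.2 hb), hd]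
    rcases hH with h2 | h2
    · exact Or.inl fun V hV => h2 _ ((le_iff _ _).1 hV.1 _) (aux V hV)
    · exact Or.inr fun V hV => h2 _ ((le_iff _ _).1 hV.1 _) (aux V hV)

end Pigeon
section Ellentuck
variable {N : ℕ}

theorem open_nbhd {O : Set (RN N)} (hO : @IsOpen (RN N) (ellTN N) O) :
    ∀ Z ∈ O, ∃ n, Bk n Z ⊆ O := by
  have hO' : TopologicalSpace.GenerateOpen {S | ∃ a X, S = EBasicN N a X} O := hO
  induction hO' with
  | basic s hs =>
    obtain ⟨a, X, rfl⟩ := hs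
    intro Z hZ
    refine ⟨a.length, fun U hU => ⟨leN_trans hU.1 hZ.1, ?_⟩⟩
    rw [← hZ.2, restr_length, restr_eq_iff]
    exact hU.2
  | univ => exact fun Z _ => ⟨0, Set.subset_univ _⟩
  | inter s t hs ht ihs iht =>
    intro Z hZ
    obtain ⟨n, hn⟩ := ihs hs Z hZ.1
    obtain ⟨m, hm⟩ := iht ht Z hZ.2
    exact ⟨max n m, fun U hU => ⟨hn (Bk_anti (le_max_left _ _) hU),
      hm (Bk_anti (le_max_right _ _) hU)⟩⟩
  | sUnion S hS ih =>
    rintro Z ⟨s, hs, hZ⟩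
    obtain ⟨n, hn⟩ := ih s hs (hS s hs) Z hZ
    exact ⟨n, fun U hU => ⟨s, hs, hn hU⟩⟩

theorem EB_open (b : List (CreatureN N)) (X : RN N) : @IsOpen (RN N) (ellTN N) (EBasicN N b X) :=
  TopologicalSpace.GenerateOpen.basic _ ⟨b, X, rfl⟩

theorem restr_succ (V : RN N) (n : ℕ) :
    restrN N V.1 (n + 1) = restrN N V.1 n ++ [V.1 n] := by
  unfold restrN
  rw [List.ofFn_succ_last]
  simp

theorem open_ramsey (hN : 0 < N) {O : Set (RN N)} (hO : @IsOpen (RN N) (ellTN N) O) (k : ℕ)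
    (X : RN N) : ∃ Y ∈ Bk k X, Bk k Y ⊆ O ∨ Bk k Y ∩ O = ∅ := by
  obtain ⟨Y0, hY0, hD1⟩ := fusion k X
    (fun b Y => EBasicN N b Y ⊆ O ∨
      ∀ Z : RN N, leN N Z.1 Y.1 → (EBasicN N b Z).Nonempty → ¬ EBasicN N b Z ⊆ O)
    (by
      rintro b Y Z hle (h | h)
      · exact Or.inl ((EB_mono hle).trans h)
      · exact Or.inr fun V hV => h V (leN_trans hV hle))
    (by
      intro b Y d _ _ hdep
      by_cases h : ∀ Z : RN N, leN N Z.1 Y.1 → (EBasicN N b Z).Nonempty → ¬ EBasicN N b Z ⊆ O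
      · exact ⟨Y, Bk_self _ _, Or.inr h⟩
      · push Not at h
        obtain ⟨Z, hZY, hne, hZO⟩ := h
        obtain ⟨Z', hZ', hs⟩ := amalg hdep hZY hne
        exact ⟨Z', hZ', Or.inl (hs.trans hZO)⟩)
  by_cases hacc : Bk k Y0 ⊆ O
  · exact ⟨Y0, hY0, Or.inl hacc⟩
  let Rej : List (CreatureN N) → Prop := fun b =>
    ∀ Z : RN N, leN N Z.1 Y0.1 → (EBasicN N b Z).Nonempty → ¬ EBasicN N b Z ⊆ O
  have hdec : ∀ V : RN N, leN N V.1 Y0.1 → ∀ n, k ≤ n → ¬ Rej (restrN N V.1 n) →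
      EBasicN N (restrN N V.1 n) Y0 ⊆ O := by
    intro V hV n hn hr
    obtain ⟨d, hd, hdep⟩ := dep_of_le hV n
    rcases hD1 d (hn.trans hd) _ hdep with h | h
    · exact h
    · exact absurd h hr
  have hk : Rej (restrN N Y0.1 k) := by
    by_contra h
    have := hdec Y0 (leN_refl Y0) k le_rfl h
    rw [Bk_eq] at this
    exact hacc this
  obtain ⟨Z, hZ, hD2⟩ := fusion k Y0
    (fun b Z => k ≤ b.length → Rej b → ∀ V ∈ EBasicN N b Z, Rej (restrN N V.1 (b.length + 1)))
    (by
      intro b Y Z hle h h1 h2 V hV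
      exact h h1 h2 V (EB_mono hle hV))
    (by
      intro b Y d hY _ hdep
      by_cases hb : k ≤ b.length ∧ Rej b
      swap
      · exact ⟨Y, Bk_self _ _, fun h1 h2 => absurd ⟨h1, h2⟩ hb⟩
      obtain ⟨Z, hZ, h | h⟩ := pigeon hN hdep (fun c => Rej (b ++ [c]))
      · refine ⟨Z, hZ, fun _ _ V hV => ?_⟩
        rw [restr_succ, hV.2]
        exact h V hV
      · exfalso
        have hZY0 : leN N Z.1 Y0.1 := leN_trans hZ.1 hY.1
        refine hb.2 Z hZY0 (dep_nonempty (dep_mono hdep hZ)) ?_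
        intro V hV
        have hVY := leN_trans hV.1 hZY0
        refine hdec V hVY (b.length + 1) (by omega) ?_ ?_
        · rw [restr_succ, hV.2]; exact h V hV
        · exact mem_EB_restr.2 ⟨hVY, fun _ _ => rfl⟩)
  refine ⟨Z, Bk_trans hZ hY0, Or.inr ?_⟩
  rw [Set.eq_empty_iff_forall_notMem]
  rintro U ⟨hU, hUO⟩
  have hrej : ∀ m, Rej (restrN N U.1 (k + m)) := by
    intro m
    induction m with
    | zero =>
      rw [Nat.add_zero, restr_eq_iff.2 (Bk_trans hU hZ).2]
      exact hk
    | succ m ih =>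
      obtain ⟨d, hd, hdep⟩ := dep_of_le hU.1 (k + m)
      have := hD2 d (by omega) _ hdep
      rw [restr_length] at this
      exact this (by omega) ih U (mem_EB_restr.2 ⟨hU.1, fun _ _ => rfl⟩)
  obtain ⟨n, hn⟩ := open_nbhd hO U hUO
  have hUY0 := (Bk_trans hU hZ).1
  refine hrej n U hUY0 ⟨U, ?_⟩ ?_
  · rw [Bk_eq]; exact Bk_self _ _
  · rw [Bk_eq]
    exact fun V hV => hn (Bk_anti (by omega) hV)

theorem EB_eq_Bk {b : List (CreatureN N)} {V : RN N} (h : restrN N V.1 b.length = b) :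
    EBasicN N b V = Bk b.length V := by
  rw [← Bk_eq, h]

theorem meagre_null (hN : 0 < N) {M : Set (RN N)} (hM : @IsMeagre (RN N) (ellTN N) M) (k : ℕ)
    (X : RN N) : ∃ Y ∈ Bk k X, Bk k Y ∩ M = ∅ := by
  letI := ellTN N
  obtain ⟨S, hSo, hSd, hSc, hSM⟩ := mem_residual_iff.1 hM
  obtain ⟨f, hf⟩ := (hSc.insert Set.univ).exists_eq_range (Set.insert_nonempty _ _)
  have hfo : ∀ i, IsOpen (f i) ∧ Dense (f i) := by
    intro i
    have : f i ∈ insert Set.univ S := by rw [hf]; exact ⟨i, rfl⟩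
    rcases this with h | h
    · rw [h]; exact ⟨isOpen_univ, dense_univ⟩
    · exact ⟨hSo _ h, hSd _ h⟩
  obtain ⟨Y, hY, hD⟩ := fusion k X
    (fun b Z => ∀ i < b.length + 1, EBasicN N b Z ⊆ f i)
    (by
      intro b Y Z hle h i hi
      exact (EB_mono hle).trans (h i hi))
    (by
      intro b Y d _ _ hdep
      have : ∀ m, ∃ Z ∈ Bk d Y, ∀ i < m, EBasicN N b Z ⊆ f i := by
        intro m
        induction m with
        | zero => exact ⟨Y, Bk_self _ _, by simp⟩
        | succ m ih =>
          obtain ⟨Z, hZ, hZf⟩ := ih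
          have hdZ := dep_mono hdep hZ
          obtain ⟨W, hW⟩ := dep_nonempty hdZ
          obtain ⟨V, hV, h⟩ := open_ramsey hN (hfo m).1 b.length W
          have hVb : restrN N V.1 b.length = b := by
            rw [restr_eq_iff.2 hV.2, hW.2]
          rw [← EB_eq_Bk hVb] at h
          have hVV : V ∈ EBasicN N b V := ⟨leN_refl V, hVb⟩
          have hVf : EBasicN N b V ⊆ f m := by
            rcases h with h | h
            · exact h
            · exfalso
              have := (hfo m).2.inter_open_nonempty _ (EB_open b V) ⟨V, hVV⟩
              rw [h] at this
              exact Set.not_nonempty_empty this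
          obtain ⟨Z', hZ', hs⟩ := amalg hdZ (leN_trans hV.1 hW.1) ⟨V, hVV⟩
          refine ⟨Z', Bk_trans hZ' hZ, fun i hi => ?_⟩
          by_cases him : i = m
          · subst him; exact hs.trans hVf
          · exact (EB_mono hZ'.1).trans (hZf i (by omega))
      exact this _)
  refine ⟨Y, hY, ?_⟩
  rw [Set.eq_empty_iff_forall_notMem]
  rintro U ⟨hU, hUM⟩
  refine hSM ?_ hUM
  intro s hs
  have : s ∈ insert Set.univ S := Or.inr hs
  rw [hf] at this
  obtain ⟨i, rfl⟩ := this
  obtain ⟨d, hd, hdep⟩ := dep_of_le hU.1 (k + i)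
  refine hD d (by omega) _ hdep i (by rw [restr_length]; omega) ?_
  exact mem_EB_restr.2 ⟨hU.1, fun _ _ => rfl⟩

theorem reduce {C : Set (RN N) → Prop} (h : ∀ k (X : RN N), ∃ Y ∈ Bk k X, C (Bk k Y)) :
    ∀ a X, (EBasicN N a X).Nonempty → ∃ Y ∈ EBasicN N a X, C (EBasicN N a Y) := by
  rintro a X ⟨W, hW⟩
  obtain ⟨Y, hY, hC⟩ := h a.length W
  have hYa : restrN N Y.1 a.length = a := by rw [restr_eq_iff.2 hY.2, hW.2]
  refine ⟨Y, ⟨leN_trans hY.1 hW.1, hYa⟩, ?_⟩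
  rw [EB_eq_Bk hYa]; exact hC

theorem rn_nonempty : Nonempty (RN N) :=
  ⟨mkRN (fun n => { mdn := n, mup := n + 1, hm := Nat.lt_succ_self n, X := ∅,
                    hX := by
                      rw [Finset.empty_ssubset, Finset.nonempty_Ico]; omega
                    phi := fun _ => none, hdom := by simp, hran := by simp }) (fun _ => rfl)⟩

end Ellentuck

/- STATEMENT 16 (Theorem 2.13tRs):
For every N > 0, (PC^tt_∞(K_N, Σ_N), ≤, r) is a topological Ramsey space: every subset
with the property of Baire in the Ellentuck topology is Ramsey, and every
Ellentuck-meager subset is Ramsey null. -/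
theorem stmt16 (N : ℕ) (hN : 0 < N) :
    Nonempty (RN N) ∧
    (∀ 𝓧 : Set (RN N), BairePropN N 𝓧 → RamseyN N 𝓧) ∧
    (∀ 𝓧 : Set (RN N), @IsMeagre (RN N) (ellTN N) 𝓧 → RamseyNullN N 𝓧) := by
  refine ⟨rn_nonempty, ?_, ?_⟩
  · rintro 𝓧 ⟨O, hO, hM⟩
    refine reduce (C := fun B => B ⊆ 𝓧 ∨ B ∩ 𝓧 = ∅) fun k X => ?_
    obtain ⟨Y, hY, hYM⟩ := meagre_null hN hM k X
    obtain ⟨Z, hZ, h⟩ := open_ramsey hN hO k Y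
    have key : ∀ U ∈ Bk k Z, (U ∈ 𝓧 ↔ U ∈ O) := by
      intro U hU
      have h1 : U ∉ symmDiff 𝓧 O := fun h2 =>
        Set.eq_empty_iff_forall_notMem.1 hYM U ⟨Bk_trans hU hZ, h2⟩
      rw [Set.mem_symmDiff] at h1
      tauto
    refine ⟨Z, Bk_trans hZ hY, ?_⟩
    rcases h with h | h
    · exact Or.inl fun U hU => (key U hU).2 (h hU)
    · refine Or.inr ?_
      rw [Set.eq_empty_iff_forall_notMem] at h ⊢
      exact fun U hU => h U ⟨hU.1, (key U hU.1).1 hU.2⟩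
  · intro 𝓧 hM
    exact reduce (C := fun B => B ∩ 𝓧 = ∅) fun k X => meagre_null hN hM k X
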